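/- Let Z be a finite set with a distinguished element z and S := |Z| − 1 ≥ 1. Let p^(1), …, p^(S+1) be row-stochastic Z×Z matrices (each row a probability vector) such that the z-row of every p^(i) is the indicator vector e_z (z is absorbing). Then for every probability vector μ on Z: μᵀ (∏_{i=1}^{S+1} p^(i)) e_z ≤ μᵀ (∏_{i=1}^{S} p^(i)) e_z + Σ_{1 ≤ i₁ < i₂ ≤ S+1} μᵀ (∏_{i=1}^{i₁−1} p^(i)) (∏_{i=i₂}^{S+1} p^(i)) e_z, where matrix products are taken in increasing order of the index and empty products equal the identity matrix. -/

import Mathlib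

open Matrix

/-- `pprod p a b = p a * p (a+1) * ⋯ * p b` (the identity matrix if `b < a`), the ordered
product of the transition matrices with indices in `[a, b]`. -/
noncomputable def pprod {Z : Type*} [Fintype Z] [DecidableEq Z]
    (p : ℕ → Matrix Z Z ℝ) (a b : ℕ) : Matrix Z Z ℝ :=
  (((List.range (b + 1 - a)).map fun j => p (a + j)).prod)

section

variable {Z : Type*} [Fintype Z] [DecidableEq Z]

theorem pprod_of_lt (p : ℕ → Matrix Z Z ℝ) {a b : ℕ} (h : b < a) : pprod p a b = 1 := by
  simp [pprod, Nat.sub_eq_zero_of_le (Nat.succ_le_of_lt h)]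

theorem pprod_eq_mul (p : ℕ → Matrix Z Z ℝ) {a b : ℕ} (h : a ≤ b) :
    pprod p a b = p a * pprod p (a + 1) b := by
  obtain ⟨n, rfl⟩ := Nat.exists_eq_add_of_le h
  have h₁ : a + n + 1 - a = n + 1 := by omega
  have h₂ : a + n + 1 - (a + 1) = n := by omega
  simp only [pprod, h₁, h₂, List.range_succ_eq_map, List.map_cons, List.map_map, List.prod_cons,
    Nat.add_zero]
  congr 3
  ext j : 1
  simp [Nat.add_assoc, Nat.add_comm 1 j]

theorem pprod_mem (p : ℕ → Matrix Z Z ℝ) (M : Submonoid (Matrix Z Z ℝ)) {a b : ℕ}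
    (h : ∀ i, a ≤ i → i ≤ b → p i ∈ M) : pprod p a b ∈ M := by
  refine list_prod_mem fun x hx => ?_
  obtain ⟨j, hj, rfl⟩ := List.mem_map.1 hx
  rw [List.mem_range] at hj
  exact h _ (by omega) (by omega)

/-- The submonoid of row-stochastic matrices for which the state `z` is absorbing. -/
def absorbingStochastic (z : Z) : Submonoid (Matrix Z Z ℝ) where
  carrier := {M | M ∈ rowStochastic ℝ Z ∧ ∀ w, M z w = if w = z then 1 else 0}
  one_mem' := ⟨one_mem _, fun w => by simp [Matrix.one_apply, eq_comm]⟩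
  mul_mem' := fun {M N} hM hN => ⟨mul_mem hM.1 hN.1, fun w => by
    simp [Matrix.mul_apply, hM.2, hN.2]⟩

/-- The sum over the times `j ∈ [i, N]` of the probability that the chain started in `y` just before
step `i` is in `w` just before step `j` and in `z` after step `N`. -/
noncomputable def visitSum (p : ℕ → Matrix Z Z ℝ) (z : Z) (N i : ℕ) (w y : Z) : ℝ :=
  ∑ j ∈ Finset.Icc i N, pprod p i (j - 1) y w * pprod p j N w z

/-- The sum of the reaching probabilities of `z` over all ways of cutting out a block of
consecutive steps from the chain that starts in `y` and performs the steps `i, …, N`. -/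
noncomputable def shortcutSum (p : ℕ → Matrix Z Z ℝ) (z : Z) (N i : ℕ) (y : Z) : ℝ :=
  ∑ i₁ ∈ Finset.Icc i N, ∑ i₂ ∈ Finset.Ioc i₁ N, (pprod p i (i₁ - 1) * pprod p i₂ N) y z

theorem mulVec_visitSum (p : ℕ → Matrix Z Z ℝ) (z : Z) (N i : ℕ) (w y : Z) :
    ∑ x, p i y x * visitSum p z N (i + 1) w x =
      ∑ j ∈ Finset.Ioc i N, pprod p i (j - 1) y w * pprod p j N w z := by
  simp only [visitSum, Finset.mul_sum]
  rw [Finset.sum_comm]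
  refine Finset.sum_congr (Finset.Icc_add_one_left_eq_Ioc i N) fun j hj => ?_
  rw [Finset.mem_Ioc] at hj
  rw [pprod_eq_mul p (show i ≤ j - 1 by omega), Matrix.mul_apply, Finset.sum_mul]
  simp only [mul_assoc]

theorem visitSum_eq (p : ℕ → Matrix Z Z ℝ) (z : Z) {N i : ℕ} (hi : 1 ≤ i) (hN : i ≤ N) (w y : Z) :
    visitSum p z N i w y =
      (if y = w then pprod p i N w z else 0) + ∑ x, p i y x * visitSum p z N (i + 1) w x := by
  rw [mulVec_visitSum, visitSum, ← Finset.add_sum_Ioc_eq_sum_Icc hN,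
    pprod_of_lt p (show i - 1 < i by omega), Matrix.one_apply, ite_mul, one_mul, zero_mul]

theorem shortcutSum_eq (p : ℕ → Matrix Z Z ℝ) (z : Z) {N i : ℕ} (hi : 1 ≤ i) (hN : i ≤ N) (y : Z) :
    shortcutSum p z N i y =
      ∑ j ∈ Finset.Ioc i N, pprod p j N y z + ∑ x, p i y x * shortcutSum p z N (i + 1) x := by
  rw [shortcutSum, ← Finset.add_sum_Ioc_eq_sum_Icc hN, pprod_of_lt p (show i - 1 < i by omega)]
  simp only [Matrix.one_mul, shortcutSum, Finset.mul_sum]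
  congr 1
  rw [Finset.sum_comm]
  refine Finset.sum_congr (Finset.Icc_add_one_left_eq_Ioc i N).symm fun j hj => ?_
  rw [Finset.mem_Icc] at hj
  rw [Finset.sum_comm]
  refine Finset.sum_congr rfl fun k _ => ?_
  rw [pprod_eq_mul p (show i ≤ j - 1 by omega), Matrix.mul_assoc, Matrix.mul_apply]

/-- A path reaching `z` exactly at step `S + 1` either meets the set `A` or repeats a state, as
soon as it is too long to stay injective outside of `A ∪ {z}`. -/
theorem pprod_apply_le_add_visitSum_add_shortcutSum (z : Z) {S : ℕ} (hS : Fintype.card Z = S + 1)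
    (p : ℕ → Matrix Z Z ℝ) (hp : ∀ i, 1 ≤ i → i ≤ S + 1 → p i ∈ absorbingStochastic z)
    {i : ℕ} (hi : 1 ≤ i) (hiS : i ≤ S + 1) (A : Finset Z) (hA : A.card + 1 = i) (hz : z ∉ A)
    (y : Z) :
    pprod p i (S + 1) y z ≤
      pprod p i S y z + ∑ w ∈ A, visitSum p z (S + 1) i w y + shortcutSum p z (S + 1) i y := by
  have hmem : ∀ a b, 1 ≤ a → b ≤ S + 1 → pprod p a b ∈ absorbingStochastic z := fun a b ha hb =>
    pprod_mem p _ fun j hj hj' => hp j (by omega) (by omega)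
  have hnn : ∀ a b, 1 ≤ a → b ≤ S + 1 → ∀ x w, 0 ≤ pprod p a b x w := fun a b ha hb x w =>
    nonneg_of_mem_rowStochastic (hmem a b ha hb).1
  have hvisit : ∀ w x, ∀ j, 1 ≤ j → 0 ≤ visitSum p z (S + 1) j w x := fun w x j hj =>
    Finset.sum_nonneg fun k hk => by
      rw [Finset.mem_Icc] at hk
      exact mul_nonneg (hnn _ _ hj (by omega) _ _) (hnn _ _ (by omega) le_rfl _ _)
  have hcut : ∀ x, 0 ≤ shortcutSum p z (S + 1) i x := fun x =>
    Finset.sum_nonneg fun j hj => Finset.sum_nonneg fun k hk => by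
      rw [Finset.mem_Icc] at hj
      rw [Finset.mem_Ioc] at hk
      exact nonneg_of_mem_rowStochastic
        (mul_mem (hmem _ _ hi (by omega)) (hmem _ _ (by omega) le_rfl)).1
  have hpi : ∀ x w, 0 ≤ p i x w := fun x w => nonneg_of_mem_rowStochastic (hp i hi hiS).1
  by_cases hyz : y = z
  · subst hyz
    rw [(hmem i (S + 1) hi le_rfl).2, (hmem i S hi (by omega)).2]
    linarith [hcut y, Finset.sum_nonneg fun w (_ : w ∈ A) => hvisit w y i hi]
  by_cases hyA : y ∈ A
  · have h₁ : visitSum p z (S + 1) i y y ≤ ∑ w ∈ A, visitSum p z (S + 1) i w y :=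
      Finset.single_le_sum (f := fun w => visitSum p z (S + 1) i w y)
        (fun w _ => hvisit w y i hi) hyA
    have h₂ : 0 ≤ ∑ x, p i y x * visitSum p z (S + 1) (i + 1) y x :=
      Finset.sum_nonneg fun x _ => mul_nonneg (hpi y x) (hvisit y x (i + 1) (by omega))
    rw [visitSum_eq p z hi hiS, if_pos rfl] at h₁
    linarith [hcut y, hnn i S hi (by omega) y z]
  have hcard : i ≤ S := by
    have h := Finset.card_le_univ (insert z (insert y A))
    rw [Finset.card_insert_of_notMem (by simp [Ne.symm hyz, hz]),
      Finset.card_insert_of_notMem hyA, hS] at h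
    omega
  have ih := pprod_apply_le_add_visitSum_add_shortcutSum z hS p hp (i := i + 1) (by omega)
    (by omega) (insert y A) (by rw [Finset.card_insert_of_notMem hyA, hA])
    (by simp [Ne.symm hyz, hz])
  have hreturn : ∑ x, p i y x * visitSum p z (S + 1) (i + 1) y x ≤
      ∑ j ∈ Finset.Ioc i (S + 1), pprod p j (S + 1) y z := by
    rw [mulVec_visitSum]
    refine Finset.sum_le_sum fun j hj => ?_
    rw [Finset.mem_Ioc] at hj
    exact mul_le_of_le_one_left (hnn _ _ (by omega) le_rfl _ _)
      (le_one_of_mem_rowStochastic (hmem _ _ hi (by omega)).1)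
  have hmeet : ∑ w ∈ A, ∑ x, p i y x * visitSum p z (S + 1) (i + 1) w x ≤
      ∑ w ∈ A, visitSum p z (S + 1) i w y := by
    refine Finset.sum_le_sum fun w _ => ?_
    rw [visitSum_eq p z hi hiS]
    refine le_add_of_nonneg_left ?_
    split_ifs
    exacts [hnn _ _ hi le_rfl _ _, le_rfl]
  have hstep := Finset.sum_le_sum fun x (_ : x ∈ Finset.univ) =>
    mul_le_mul_of_nonneg_left (ih x) (hpi y x)
  simp only [mul_add, Finset.sum_add_distrib, Finset.sum_insert hyA, Finset.mul_sum] at hstep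
  rw [Finset.sum_comm (t := A)] at hstep
  rw [pprod_eq_mul p hiS, pprod_eq_mul p hcard, Matrix.mul_apply, Matrix.mul_apply,
    shortcutSum_eq p z hi hiS]
  linarith
termination_by S + 1 - i

end

/-- Combinatorial core of the horizon-shortening lemma: if `z` is absorbing for each of the
row-stochastic matrices `p^(1), …, p^(S+1)` (where `S = |Z| − 1 ≥ 1`), then for every
probability vector `μ` on `Z`,
`μᵀ(∏_{i=1}^{S+1} p^(i)) e_z ≤ μᵀ(∏_{i=1}^{S} p^(i)) e_z
  + Σ_{1 ≤ i₁ < i₂ ≤ S+1} μᵀ(∏_{i=1}^{i₁−1} p^(i))(∏_{i=i₂}^{S+1} p^(i)) e_z`. -/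
theorem absorbing_product_inequality {Z : Type*} [Fintype Z] [DecidableEq Z]
    (z : Z) (S : ℕ) (hS : S = Fintype.card Z - 1) (hS1 : 1 ≤ S)
    (p : ℕ → Matrix Z Z ℝ)
    (hnonneg : ∀ i ∈ Finset.Icc 1 (S + 1), ∀ w w', 0 ≤ p i w w')
    (hrow : ∀ i ∈ Finset.Icc 1 (S + 1), ∀ w, ∑ w', p i w w' = 1)
    (habs : ∀ i ∈ Finset.Icc 1 (S + 1), ∀ w, p i z w = if w = z then 1 else 0)
    (μ : Z → ℝ) (hμ0 : ∀ w, 0 ≤ μ w) (hμ1 : ∑ w, μ w = 1) :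
    μ ⬝ᵥ (pprod p 1 (S + 1)).mulVec (fun w => if w = z then 1 else 0) ≤
      μ ⬝ᵥ (pprod p 1 S).mulVec (fun w => if w = z then 1 else 0) +
        ∑ i₁ ∈ Finset.Icc 1 (S + 1), ∑ i₂ ∈ Finset.Icc 1 (S + 1),
          if i₁ < i₂ then
            μ ⬝ᵥ ((pprod p 1 (i₁ - 1)) * pprod p i₂ (S + 1)).mulVec
              (fun w => if w = z then 1 else 0)
          else 0 := by
  have hcard : Fintype.card Z = S + 1 := by omega
  have hp : ∀ i, 1 ≤ i → i ≤ S + 1 → p i ∈ absorbingStochastic z := fun i h₁ h₂ => by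
    have hi := Finset.mem_Icc.2 ⟨h₁, h₂⟩
    exact ⟨mem_rowStochastic_iff_sum.2 ⟨hnonneg i hi, hrow i hi⟩, habs i hi⟩
  have hmulVec : ∀ M : Matrix Z Z ℝ,
      μ ⬝ᵥ M.mulVec (fun w => if w = z then 1 else 0) = ∑ y, μ y * M y z := fun M => by
    simp [dotProduct, Matrix.mulVec]
  have hsum : ∑ i₁ ∈ Finset.Icc 1 (S + 1), ∑ i₂ ∈ Finset.Icc 1 (S + 1),
      (if i₁ < i₂ then ∑ y, μ y * (pprod p 1 (i₁ - 1) * pprod p i₂ (S + 1)) y z else 0) =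
      ∑ y, μ y * shortcutSum p z (S + 1) 1 y := by
    simp only [shortcutSum, Finset.mul_sum]
    rw [Finset.sum_comm (s := (Finset.univ : Finset Z))]
    refine Finset.sum_congr rfl fun i₁ hi₁ => ?_
    rw [← Finset.sum_filter, Finset.sum_comm (s := (Finset.univ : Finset Z))]
    refine Finset.sum_congr ?_ fun _ _ => rfl
    ext i₂
    simp only [Finset.mem_filter, Finset.mem_Icc, Finset.mem_Ioc] at hi₁ ⊢
    omega
  simp only [hmulVec]
  rw [hsum, ← Finset.sum_add_distrib]
  refine Finset.sum_le_sum fun y _ => ?_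
  rw [← mul_add]
  refine mul_le_mul_of_nonneg_left ?_ (hμ0 y)
  simpa using pprod_apply_le_add_visitSum_add_shortcutSum z hcard p hp le_rfl (by omega) ∅
    (by simp) (by simp) y
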